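/- Let (F_1,…,F_m;k) be an instance of the hMaf problem satisfying the label-set isomorphism property, in which {a,b} is a minimum maximal sibling-set of the instance lying in F_1, and suppose there is an X-forest F_p with |E_{F_p}(a,b)| ≥ 2 (Case 2.1). Then Branching Rule 2.1 — branch into three instances: [1] remove the edge incident to a in all X-forests; [2] remove the edge incident to b in all X-forests; [3] remove the edges of E_{F_i}(a,b) in every F_i for 2 ≤ i ≤ m — is safe, and it satisfies the recurrence relation T(k) ≤ 2T(k−1) + T(k−2). -/

import Mathlib

/-!
A formalization framework for the Maximum Agreement Forest problem on multiple
rooted multifurcating phylogenetic trees.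

An `X`-forest is modeled (up to forced contraction and label-preserving
isomorphism) by the laminar family of the label-sets `L(v)` of its vertices:
every vertex `v` is identified with the set `L(v)` of labels at its leaf
descendants, components correspond to the maximal clusters, leaves to the
singleton clusters, and the edge between a non-root vertex `v` and its parent
is identified with the cluster `L(v)`.
-/

open Finset

noncomputable section
open scoped Classical

/-- A rooted multifurcating phylogenetic `X`-forest, described by the laminar
family of the label sets of its vertices. -/
structure XForest (X : Type*) where
  clusters : Finset (Finset X)
  nonempty_of_mem : ∀ s ∈ clusters, s.Nonempty
  laminar : ∀ s ∈ clusters, ∀ t ∈ clusters, ¬Disjoint s t → s ⊆ t ∨ t ⊆ s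
  singleton_mem : ∀ x : X, {x} ∈ clusters

namespace XForest

variable {X : Type*} [DecidableEq X] [Fintype X]

/-- The connected components of an `X`-forest: the maximal clusters.  The
component `C` is identified with its label set `L(C)`. -/
def components (F : XForest X) : Finset (Finset X) :=
  F.clusters.filter fun s => ∀ t ∈ F.clusters, ¬s ⊂ t

/-- The order of an `X`-forest: its number of connected components. -/
def ord (F : XForest X) : ℕ := F.components.card

/-- `c` is (the cluster of) a child of (the vertex with cluster) `p`. -/
def IsChild (F : XForest X) (c p : Finset X) : Prop :=
  c ∈ F.clusters ∧ p ∈ F.clusters ∧ c ⊂ p ∧ ∀ t ∈ F.clusters, c ⊂ t → ¬t ⊂ p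

/-- The family obtained from the laminar family `A` by removing, for every
`d ∈ D`, the edge between the vertex with cluster `d` and its parent. -/
def cutFam (A D : Finset (Finset X)) : Finset (Finset X) :=
  (A.image fun s => s \ (D.filter fun d => d ⊂ s).biUnion id).filter fun s => s.Nonempty

/-- The `X`-forest obtained from `F` by removing the edges above the clusters
in `D` (followed by forced contraction). -/
def cut (F : XForest X) (D : Finset (Finset X)) : XForest X where
  clusters := cutFam F.clusters (D.filter fun d => d ∈ F.clusters)
  nonempty_of_mem := fun s hs => (Finset.mem_filter.mp hs).2
  laminar := by
    intro s' hs' t' ht' hnd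
    set D' : Finset (Finset X) := D.filter fun d => d ∈ F.clusters with hD'def
    have hD'sub : ∀ d ∈ D', d ∈ F.clusters := fun d hd => (Finset.mem_filter.mp hd).2
    obtain ⟨hs'm, -⟩ := Finset.mem_filter.mp hs'
    obtain ⟨s, hs, rfl⟩ := Finset.mem_image.mp hs'm
    obtain ⟨ht'm, -⟩ := Finset.mem_filter.mp ht'
    obtain ⟨t, ht, rfl⟩ := Finset.mem_image.mp ht'm
    obtain ⟨x, hxs, hxt⟩ := Finset.not_disjoint_iff.mp hnd
    have key : ∀ u ∈ F.clusters, ∀ w ∈ F.clusters, u ⊆ w →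
        ∀ z, z ∈ u \ (D'.filter fun d => d ⊂ u).biUnion id →
          z ∈ w \ (D'.filter fun d => d ⊂ w).biUnion id →
          u \ (D'.filter fun d => d ⊂ u).biUnion id ⊆
            w \ (D'.filter fun d => d ⊂ w).biUnion id := by
      intro u hu w hw huw z hzu hzw y hy
      rw [Finset.mem_sdiff] at hy hzu hzw ⊢
      refine ⟨huw hy.1, ?_⟩
      intro hyU
      rw [Finset.mem_biUnion] at hyU
      obtain ⟨d, hd, hyd⟩ := hyU
      rw [Finset.mem_filter] at hd
      have hdF : d ∈ F.clusters := hD'sub d hd.1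
      have hdw : d ⊂ w := hd.2
      have hlam := F.laminar d hdF u hu (Finset.not_disjoint_iff.mpr ⟨y, hyd, hy.1⟩)
      rcases hlam with hdu | hud
      · by_cases hde : d = u
        · exact hzw.2 (Finset.mem_biUnion.mpr
            ⟨d, Finset.mem_filter.mpr ⟨hd.1, hdw⟩, hde ▸ hzu.1⟩)
        · have hss : d ⊂ u := Finset.ssubset_iff_subset_ne.mpr ⟨hdu, hde⟩
          exact hy.2 (Finset.mem_biUnion.mpr
            ⟨d, Finset.mem_filter.mpr ⟨hd.1, hss⟩, hyd⟩)
      · exact hzw.2 (Finset.mem_biUnion.mpr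
          ⟨d, Finset.mem_filter.mpr ⟨hd.1, hdw⟩, hud hzu.1⟩)
    have hxs' : x ∈ s ∧ x ∈ t := by
      constructor
      · exact (Finset.mem_sdiff.mp hxs).1
      · exact (Finset.mem_sdiff.mp hxt).1
    rcases F.laminar s hs t ht (Finset.not_disjoint_iff.mpr ⟨x, hxs'.1, hxs'.2⟩) with hst | hts
    · exact Or.inl (key s hs t ht hst x hxs hxt)
    · exact Or.inr (key t ht s hs hts x hxt hxs)
  singleton_mem := by
    intro x
    have hU : ((D.filter fun d => d ∈ F.clusters).filter fun d => d ⊂ ({x} : Finset X)) = ∅ := by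
      rw [Finset.filter_eq_empty_iff]
      intro d hd hss
      have hne := F.nonempty_of_mem d (Finset.mem_filter.mp hd).2
      rw [Finset.ssubset_singleton_iff.mp hss] at hne
      exact Finset.not_nonempty_empty hne
    refine Finset.mem_filter.mpr ⟨?_, Finset.singleton_nonempty x⟩
    refine Finset.mem_image.mpr ⟨{x}, F.singleton_mem x, ?_⟩
    rw [hU]
    simp

/-- `G` is a subforest of `F` (up to forced contraction and label-preserving
isomorphism): `G` is obtained from `F` by removing a set of edges. -/
def IsSubforest (G F : XForest X) : Prop :=
  ∃ D ⊆ F.clusters, G.clusters = (F.cut D).clusters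

/-- The edge of `F` between the vertex with cluster `c` and its parent is *in*
the forest `G` (i.e. it lies on a path of `F` connecting two labels that belong
to a common connected component of `G`). -/
def EdgeUsed (F : XForest X) (c : Finset X) (G : XForest X) : Prop :=
  ∃ x ∈ c, ∃ y, y ∉ c ∧ (∃ C ∈ F.components, x ∈ C ∧ y ∈ C) ∧
    ∃ D ∈ G.components, x ∈ D ∧ y ∈ D

/-- The least common ancestor of the two labels `a` and `b` in `F` (given as
its cluster, i.e. as the label set `L(lca_F(a,b))`). -/
def lca2 (F : XForest X) (a b : X) : Finset X :=
  (F.clusters.filter fun s => a ∈ s ∧ b ∈ s).inf id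

/-- The least common ancestor of the labels of `S` in `F` (given as its
cluster). -/
def lcaS (F : XForest X) (S : Finset X) : Finset X :=
  (F.clusters.filter fun s => S ⊆ s).inf id

/-- `E^1_F(a,b)`: the edges of `F` that are not on the path `P` connecting the
labels `a` and `b` but are incident to internal vertices of this path other
than `lca_F(a,b)` (each edge is identified with the cluster of its lower
endpoint). -/
def E1 (F : XForest X) (a b : X) : Finset (Finset X) :=
  F.clusters.filter fun d => ∃ c ∈ F.clusters, F.IsChild d c ∧ c ⊂ F.lca2 a b ∧
    ((a ∈ c ∧ c ≠ {a} ∧ a ∉ d) ∨ (b ∈ c ∧ c ≠ {b} ∧ b ∉ d))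

/-- `E^2_F(a,b)`: the edges incident to `lca_F(a,b)` other than the two edges
on the path connecting `a` and `b` and the edge to the parent of the lca. -/
def E2 (F : XForest X) (a b : X) : Finset (Finset X) :=
  F.clusters.filter fun d => F.IsChild d (F.lca2 a b) ∧ a ∉ d ∧ b ∉ d

/-- `E_F(a,b) = E^1_F(a,b) ∪ E^2_F(a,b)`. -/
def Eset (F : XForest X) (a b : X) : Finset (Finset X) := F.E1 a b ∪ F.E2 a b

/-- `E^O_F(S)`: the edges between `lca_F(S)` and its children that are not
labels in `S`. -/
def EO (F : XForest X) (S : Finset X) : Finset (Finset X) :=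
  F.clusters.filter fun d => F.IsChild d (F.lcaS S) ∧ ∀ x ∈ S, d ≠ {x}

/-- `S` is a maximal sibling set (MSS) of `F`: the leaves with labels in `S`
have a common parent `p` whose children are exactly the labels in `S`
(equivalently, `S` itself is a cluster all of whose proper subclusters are
singletons). -/
def IsMSS (F : XForest X) (S : Finset X) : Prop :=
  S ∈ F.clusters ∧ 2 ≤ S.card ∧ ∀ c ∈ F.clusters, c ⊂ S → c.card = 1

/-- the labels in `S` are (pairwise) siblings in `F`, i.e., they have a common
parent. -/
def Siblings (F : XForest X) (S : Finset X) : Prop :=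
  ∃ p ∈ F.clusters, ∀ x ∈ S, F.IsChild {x} p

/-- An `X`-forest is binary if each of its non-leaf vertices has exactly two
children. -/
def IsBinary (F : XForest X) : Prop :=
  ∀ s ∈ F.clusters, 2 ≤ s.card → ∃ c₁ c₂ : Finset X, c₁ ≠ c₂ ∧
    F.IsChild c₁ s ∧ F.IsChild c₂ s ∧ ∀ c, F.IsChild c s → c = c₁ ∨ c = c₂

/-- `B` is a resolution of `F`: `F` can be obtained from `B` by contracting
internal edges. -/
def IsResolution (B F : XForest X) : Prop :=
  F.clusters ⊆ B.clusters ∧ B.components = F.components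

/-- `G` is a binary subforest of `F`: `G` is binary and is a subforest of some
binary resolution of `F`. -/
def IsBinarySubforest (G F : XForest X) : Prop :=
  G.IsBinary ∧ ∃ B : XForest X, B.IsBinary ∧ IsResolution B F ∧ IsSubforest G B

end XForest

variable {X : Type*} [DecidableEq X] [Fintype X] {m : ℕ}

/-- A hard agreement forest for the `X`-forests `Fs`. -/
def IsHAF (Fs : Fin m → XForest X) (G : XForest X) : Prop :=
  ∀ i, XForest.IsSubforest G (Fs i)

/-- A hard maximum agreement forest (hMAF) for the `X`-forests `Fs`. -/
def IsHMAF (Fs : Fin m → XForest X) (G : XForest X) : Prop :=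
  IsHAF Fs G ∧ ∀ G', IsHAF Fs G' → G.ord ≤ G'.ord

/-- A soft agreement forest for the `X`-forests `Fs`. -/
def IsSAF (Fs : Fin m → XForest X) (G : XForest X) : Prop :=
  ∀ i, XForest.IsBinarySubforest G (Fs i)

/-- A soft maximum agreement forest (sMAF) for the `X`-forests `Fs`. -/
def IsSMAF (Fs : Fin m → XForest X) (G : XForest X) : Prop :=
  IsSAF Fs G ∧ ∀ G', IsSAF Fs G' → G.ord ≤ G'.ord

/-- An instance `(F_1, …, F_m; k)` of the (hard or soft) Maf problem. -/
structure Inst (X : Type*) (m : ℕ) where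
  F : Fin m → XForest X
  k : ℤ

namespace Inst

/-- the largest order of an `X`-forest in the instance. -/
def ordMax (I : Inst X m) : ℕ := Finset.univ.sup fun i => (I.F i).ord

/-- a solution of an instance of the hMaf problem: a hard agreement forest
whose order is at most `ordMax + k`. -/
def IsSolution (I : Inst X m) (G : XForest X) : Prop :=
  IsHAF I.F G ∧ (G.ord : ℤ) ≤ (I.ordMax : ℤ) + I.k

/-- a yes-instance of the hMaf problem. -/
def IsYes (I : Inst X m) : Prop := ∃ G, I.IsSolution G

/-- a solution of an instance of the sMaf problem. -/
def IsSSolution (I : Inst X m) (G : XForest X) : Prop :=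
  IsSAF I.F G ∧ (G.ord : ℤ) ≤ (I.ordMax : ℤ) + I.k

/-- a yes-instance of the sMaf problem. -/
def IsSYes (I : Inst X m) : Prop := ∃ G, I.IsSSolution G

/-- `S` is a minimum maximal sibling set of the instance `I`, lying in the
`i`-th forest. -/
def MinMSS (I : Inst X m) (i : Fin m) (S : Finset X) : Prop :=
  (I.F i).IsMSS S ∧ ∀ j : Fin m, ∀ S' : Finset X, (I.F j).IsMSS S' → S.card ≤ S'.card

end Inst

/-- the new value of the parameter after removing one edge from the `j`-th
forest (the maximum order `ordMax + k` stays invariant). -/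
def cutk (I : Inst X m) (j : Fin m) : ℤ :=
  if (I.F j).ord = I.ordMax then I.k - 1 else I.k

/-- Reduction Rule 1 is applicable on `Fj` relative to `Fi`, at the vertex `v`
of `Fj` (whose parent edge is to be removed): there is a subset
`{C_1, …, C_t}` (`t ≥ 1`) of the components of `Fi` and a component `C` of
`Fj` containing a non-root vertex `v` with
`L(v) = L(C) ∩ (L(C_1) ∪ … ∪ L(C_t))`. -/
def RR1App (Fi Fj : XForest X) (v : Finset X) : Prop :=
  ∃ 𝒞 ⊆ Fi.components, 𝒞.Nonempty ∧
    ∃ C ∈ Fj.components, v ∈ Fj.clusters ∧ v ⊆ C ∧ (∃ t ∈ Fj.clusters, v ⊂ t) ∧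
      v = C ∩ 𝒞.biUnion id

/-- One application of Reduction Rule 1 to the instance `I`, producing `I'`. -/
def RR1Step (I I' : Inst X m) : Prop :=
  ∃ i j, i ≠ j ∧ ∃ v, RR1App (I.F i) (I.F j) v ∧
    I' = ⟨Function.update I.F j ((I.F j).cut {v}), cutk I j⟩

/-- Reduction Rule 1 is applicable somewhere on the instance `I`. -/
def RR1Applicable (I : Inst X m) : Prop :=
  ∃ i j, i ≠ j ∧ ∃ v, RR1App (I.F i) (I.F j) v

/-- `I'` is obtained from `I` by applying Reduction Rule 1 repeatedly until it
is no longer applicable. -/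
def RR1Exhaust (I I' : Inst X m) : Prop :=
  Relation.ReflTransGen RR1Step I I' ∧ ¬RR1Applicable I'

/-- The situation of Case 1 (Branching Rule 1) for `Fj` relative to `Fi`:
there is a component `C` of `Fi` and a vertex `v` of `Fj` with two children
`c₁, c₂` such that `L(c₁) ⊆ L(C)` and `L(c₂) ∩ L(C) = ∅`. -/
def BR1AppCore (Fi Fj : XForest X) (v c₁ c₂ : Finset X) : Prop :=
  ∃ C ∈ Fi.components, Fj.IsChild c₁ v ∧ Fj.IsChild c₂ v ∧ c₁ ≠ c₂ ∧
    c₁ ⊆ C ∧ c₂ ∩ C = ∅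

/-- An application of Branching Rule 1 to the instance `I` (on the forest with
index `j`, relative to the forest with index `i`), branching into the two
instances `I₁` (removing `[v,c₁]`) and `I₂` (removing `[v,c₂]`). -/
def BR1Branch (I : Inst X m) (i j : Fin m) (v c₁ c₂ : Finset X)
    (I₁ I₂ : Inst X m) : Prop :=
  i ≠ j ∧ BR1AppCore (I.F i) (I.F j) v c₁ c₂ ∧
    I₁ = ⟨Function.update I.F j ((I.F j).cut {c₁}), cutk I j⟩ ∧
    I₂ = ⟨Function.update I.F j ((I.F j).cut {c₂}), cutk I j⟩

/-- two `X`-forests satisfy the label-set isomorphism property. -/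
def LabelIso (F F' : XForest X) : Prop := F.components = F'.components

/-- an instance satisfies the label-set isomorphism property. -/
def InstLabelIso (I : Inst X m) : Prop := ∀ i j, LabelIso (I.F i) (I.F j)

/-- One computation path of the 2-BR-process on the forests with indices `p`
and `q`: repeatedly apply Branching Rule 1 between these two forests (choosing
one of the two branches) followed by an exhaustive application of Reduction
Rule 1, until the two forests satisfy the label-set isomorphism property.  The
natural number records the number of edges removed by Branching Rule 1 along
the path. -/
inductive TwoBRPath {X : Type*} [DecidableEq X] [Fintype X] {m : ℕ} (p q : Fin m) :
    Inst X m → Inst X m → ℕ → Prop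
  | done (I : Inst X m) (h : LabelIso (I.F p) (I.F q)) : TwoBRPath p q I I 0
  | step {I I₁ I₂ J K I' : Inst X m} {n : ℕ} {i j : Fin m} {v c₁ c₂ : Finset X}
      (hij : (i = p ∧ j = q) ∨ (i = q ∧ j = p))
      (hbr : BR1Branch I i j v c₁ c₂ I₁ I₂)
      (hpick : J = I₁ ∨ J = I₂)
      (hex : RR1Exhaust J K)
      (hrest : TwoBRPath p q K I' n) : TwoBRPath p q I I' (n + 1)

/-- `s` and `t` are the indices of two forests with the first and the second
largest orders in `I`. -/
def FirstSecond (I : Inst X m) (s t : Fin m) : Prop :=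
  s ≠ t ∧ (∀ i, (I.F i).ord ≤ (I.F s).ord) ∧ ∀ i, i ≠ s → (I.F i).ord ≤ (I.F t).ord

/-- One computation path of Stage 2 of the m-BR-process: repeatedly apply the
2-BR-process to two forests with first and second largest orders not
satisfying the label-set isomorphism property, until the whole instance
satisfies the label-set isomorphism property. -/
inductive MBRAux {X : Type*} [DecidableEq X] [Fintype X] {m : ℕ} :
    Inst X m → Inst X m → ℕ → Prop
  | done (I : Inst X m) (h : InstLabelIso I) : MBRAux I I 0
  | step {I J I' : Inst X m} {a b : ℕ} {s t : Fin m}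
      (hst : FirstSecond I s t) (hni : ¬LabelIso (I.F s) (I.F t))
      (h2 : TwoBRPath s t I J a) (hrest : MBRAux J I' b) : MBRAux I I' (a + b)

/-- One computation path of the m-BR-process on the instance `I`, ending at
the instance `I'`, along which `n` edges are removed by Branching Rule 1. -/
def MBRPath (I I' : Inst X m) (n : ℕ) : Prop :=
  ∃ J, RR1Exhaust I J ∧ MBRAux J I' n

/-- The full branching tree of the 2-BR-process on the forests with indices
`p` and `q`, producing the collection (list) of resulting instances, each
together with the number of edges removed by Branching Rule 1 on its
computation path. -/
inductive TwoBRTree {X : Type*} [DecidableEq X] [Fintype X] {m : ℕ} (p q : Fin m) :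
    Inst X m → List (Inst X m × ℕ) → Prop
  | done (I : Inst X m) (h : LabelIso (I.F p) (I.F q)) : TwoBRTree p q I [(I, 0)]
  | step {I I₁ I₂ K₁ K₂ : Inst X m} {L₁ L₂ : List (Inst X m × ℕ)}
      {i j : Fin m} {v c₁ c₂ : Finset X}
      (hij : (i = p ∧ j = q) ∨ (i = q ∧ j = p))
      (hbr : BR1Branch I i j v c₁ c₂ I₁ I₂)
      (he₁ : RR1Exhaust I₁ K₁) (he₂ : RR1Exhaust I₂ K₂)
      (h₁ : TwoBRTree p q K₁ L₁) (h₂ : TwoBRTree p q K₂ L₂) :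
      TwoBRTree p q I ((L₁ ++ L₂).map fun x => (x.1, x.2 + 1))

/-- One step of Stage 2 of the m-BR-process on a collection of instances:
replace an instance, in which two forests of first and second largest orders
do not satisfy the label-set isomorphism property, by the collection produced
by the 2-BR-process on those two forests. -/
inductive CollStep {X : Type*} [DecidableEq X] [Fintype X] {m : ℕ} :
    List (Inst X m × ℕ) → List (Inst X m × ℕ) → Prop
  | step {I : Inst X m} {n : ℕ} {A B L : List (Inst X m × ℕ)} {s t : Fin m}
      (hst : FirstSecond I s t) (hni : ¬LabelIso (I.F s) (I.F t))
      (h : TwoBRTree s t I L) :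
      CollStep (A ++ (I, n) :: B) (A ++ L.map (fun y => (y.1, y.2 + n)) ++ B)

/-- The m-BR-process on the instance `I` produces the collection `L` of
instances (each recorded with the number of edges removed by Branching Rule 1
on the path leading to it): Stage 1 applies Reduction Rule 1 exhaustively, and
Stage 2 repeatedly applies the 2-BR-process until every instance of the
collection satisfies the label-set isomorphism property. -/
def MBRTree (I : Inst X m) (L : List (Inst X m × ℕ)) : Prop :=
  ∃ J, RR1Exhaust I J ∧ Relation.ReflTransGen CollStep [(J, 0)] L ∧
    ∀ x ∈ L, InstLabelIso x.1

/-- The 2-edge distance property of an instance. -/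
def TwoEdgeDist (I : Inst X m) : Prop :=
  ∃ (G : Inst X m) (E : Fin m → Finset (Finset X)),
    InstLabelIso G ∧ G.k = I.k + 1 ∧
    (∀ i, E i ⊆ (G.F i).clusters) ∧ (∀ i, (E i).card ≤ 1) ∧
    (∀ i, ∀ v ∈ E i, ∃ t ∈ (G.F i).clusters, v ⊂ t) ∧
    (∀ i, (I.F i).clusters = ((G.F i).cut (E i)).clusters) ∧
    ∃ i j : Fin m, i < j ∧ ∃ vi ∈ E i, ∃ vj ∈ E j, vi ≠ vj

/-- A branching step producing instances with parameters `ks` from an instance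
with parameter `k` satisfies the recurrence relation
`T(k) ≤ c₁·T(k-1) + c₂·T(k-2)`:  for every nonnegative monotone `T` satisfying
the recurrence, the sum of the `T`-values of the produced parameters is at
most `T k`. -/
def RecBound (k : ℤ) (ks : List ℤ) (c₁ c₂ : ℕ) : Prop :=
  ∀ T : ℤ → ℝ, (∀ x, 0 ≤ T x) → Monotone T →
    (∀ x : ℤ, (c₁ : ℝ) * T (x - 1) + (c₂ : ℝ) * T (x - 2) ≤ T x) →
    (ks.map T).sum ≤ T k

end

section Helpers
set_option linter.unusedSectionVars false
open scoped Classical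

namespace XForest
variable {X : Type*} [DecidableEq X] [Fintype X]

/-- two labels lie in a common component -/
def Same (F : XForest X) (x y : X) : Prop := ∃ s ∈ F.clusters, x ∈ s ∧ y ∈ s

/-- two labels lie in a common component after removing the edges in `D` -/
def Rel (F : XForest X) (D : Finset (Finset X)) (x y : X) : Prop :=
  F.Same x y ∧ ∀ d ∈ D, d ∈ F.clusters → (x ∈ d ↔ y ∈ d)

/-- `x` is still below `s` after removing the edges in `D` -/
def Low (F : XForest X) (D : Finset (Finset X)) (s : Finset X) (x : X) : Prop :=
  x ∈ s ∧ ∀ d ∈ D, d ∈ F.clusters → d ⊂ s → x ∉ d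

theorem lam (F : XForest X) {s t : Finset X} {x : X} (hs : s ∈ F.clusters)
    (ht : t ∈ F.clusters) (hxs : x ∈ s) (hxt : x ∈ t) : s ⊆ t ∨ t ⊆ s :=
  F.laminar s hs t ht (Finset.not_disjoint_iff.mpr ⟨x, hxs, hxt⟩)

theorem same_refl (F : XForest X) (x : X) : F.Same x x :=
  ⟨{x}, F.singleton_mem x, by simp, by simp⟩

theorem Same.symm {F : XForest X} {x y : X} (h : F.Same x y) : F.Same y x := by
  obtain ⟨s, hs, h1, h2⟩ := h
  exact ⟨s, hs, h2, h1⟩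

theorem Same.trans {F : XForest X} {x y z : X} (h : F.Same x y) (h' : F.Same y z) :
    F.Same x z := by
  obtain ⟨s, hs, h1, h2⟩ := h
  obtain ⟨t, ht, h3, h4⟩ := h'
  rcases F.lam hs ht h2 h3 with h | h
  · exact ⟨t, ht, h h1, h4⟩
  · exact ⟨s, hs, h1, h h4⟩

theorem rel_refl (F : XForest X) (D : Finset (Finset X)) (x : X) : F.Rel D x x :=
  ⟨F.same_refl x, fun _ _ _ => Iff.rfl⟩

theorem Rel.symm {F : XForest X} {D : Finset (Finset X)} {x y : X} (h : F.Rel D x y) :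
    F.Rel D y x := ⟨h.1.symm, fun d hd hF => (h.2 d hd hF).symm⟩

theorem Rel.trans {F : XForest X} {D : Finset (Finset X)} {x y z : X} (h : F.Rel D x y)
    (h' : F.Rel D y z) : F.Rel D x z :=
  ⟨h.1.trans h'.1, fun d hd hF => (h.2 d hd hF).trans (h'.2 d hd hF)⟩

theorem mem_cut_low (F : XForest X) (D : Finset (Finset X)) (t : Finset X) :
    t ∈ (F.cut D).clusters ↔ t.Nonempty ∧ ∃ s ∈ F.clusters, ∀ x, x ∈ t ↔ F.Low D s x := by
  have key : ∀ s x, x ∈ s \ ((D.filter fun d => d ∈ F.clusters).filter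
      fun d => d ⊂ s).biUnion id ↔ F.Low D s x := by
    intro s x
    simp only [Finset.mem_sdiff, Finset.mem_biUnion, Finset.mem_filter, id, Low]
    grind
  constructor
  · intro h
    obtain ⟨h1, h2⟩ := Finset.mem_filter.mp h
    obtain ⟨s, hs, rfl⟩ := Finset.mem_image.mp h1
    exact ⟨h2, s, hs, key s⟩
  · rintro ⟨h2, s, hs, h⟩
    refine Finset.mem_filter.mpr ⟨Finset.mem_image.mpr ⟨s, hs, ?_⟩, h2⟩
    ext x
    rw [h x]
    exact key s x

theorem low_rel (F : XForest X) (D : Finset (Finset X)) {s : Finset X} (hs : s ∈ F.clusters)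
    {x : X} (hx : F.Low D s x) (y : X) : F.Low D s y ↔ y ∈ s ∧ F.Rel D x y := by
  have aux : ∀ u v, F.Low D s u → F.Low D s v → ∀ d ∈ D, d ∈ F.clusters → u ∈ d → v ∈ d := by
    intro u v hu hv d hd hF hud
    rcases F.lam hs hF hu.1 hud with h | h
    · exact h hv.1
    · by_contra hvd
      exact hu.2 d hd hF ⟨h, fun h' => hvd (h' hv.1)⟩ hud
  constructor
  · intro hy
    exact ⟨hy.1, ⟨s, hs, hx.1, hy.1⟩, fun d hd hF => ⟨aux x y hx hy d hd hF, aux y x hy hx d hd hF⟩⟩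
  · rintro ⟨hys, h⟩
    exact ⟨hys, fun d hd hF hds hyd => hx.2 d hd hF hds ((h.2 d hd hF).2 hyd)⟩

theorem mem_cut_rel (F : XForest X) (D : Finset (Finset X)) (t : Finset X) :
    t ∈ (F.cut D).clusters ↔ ∃ s ∈ F.clusters, ∃ x ∈ s, ∀ y, y ∈ t ↔ y ∈ s ∧ F.Rel D x y := by
  rw [mem_cut_low]
  constructor
  · rintro ⟨⟨x, hx⟩, s, hs, h⟩
    have hx' := (h x).1 hx
    exact ⟨s, hs, x, hx'.1, fun y => (h y).trans (F.low_rel D hs hx' y)⟩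
  · rintro ⟨s, hs, x, hx, h⟩
    refine ⟨⟨x, (h x).2 ⟨hx, F.rel_refl D x⟩⟩, ?_⟩
    by_cases hl : F.Low D s x
    · exact ⟨s, hs, fun y => (h y).trans (F.low_rel D hs hl y).symm⟩
    · have hex : ∃ d ∈ D, d ∈ F.clusters ∧ d ⊂ s ∧ x ∈ d := by
        by_contra hcon
        push Not at hcon
        exact hl ⟨hx, hcon⟩
      have hne : (D.filter fun d => d ∈ F.clusters ∧ d ⊂ s ∧ x ∈ d).Nonempty := by
        obtain ⟨d, hd, h'⟩ := hex
        exact ⟨d, Finset.mem_filter.mpr ⟨hd, h'⟩⟩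
      obtain ⟨d, hd, hmin⟩ := Finset.exists_min_image _ Finset.card hne
      obtain ⟨hdD, hdF, hds, hxd⟩ := Finset.mem_filter.mp hd
      have hlow : F.Low D d x := by
        refine ⟨hxd, fun e he heF hed hxe => ?_⟩
        have := hmin e (Finset.mem_filter.mpr ⟨he, heF, hed.trans hds, hxe⟩)
        exact absurd (Finset.card_lt_card hed) (not_lt.mpr this)
      refine ⟨d, hdF, fun y => (h y).trans (Iff.trans ?_ (F.low_rel D hdF hlow y).symm)⟩
      constructor
      · rintro ⟨_, hr⟩
        exact ⟨(hr.2 d hdD hdF).1 hxd, hr⟩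
      · rintro ⟨hyd, hr⟩
        exact ⟨hds.1 hyd, hr⟩

theorem same_cut (F : XForest X) (D : Finset (Finset X)) (x y : X) :
    (F.cut D).Same x y ↔ F.Rel D x y := by
  constructor
  · rintro ⟨t, ht, hx, hy⟩
    obtain ⟨s, hs, z, hz, h⟩ := (F.mem_cut_rel D t).1 ht
    exact ((h x).1 hx).2.symm.trans ((h y).1 hy).2
  · intro h
    obtain ⟨s, hs, hx, hy⟩ := h.1
    refine ⟨s.filter (F.Rel D x), (F.mem_cut_rel D _).2 ⟨s, hs, x, hx, fun y => ?_⟩, ?_, ?_⟩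
    · simp
    · simp [hx, F.rel_refl D x]
    · simp [hy, h]

theorem rel_cut (F : XForest X) (D D' : Finset (Finset X)) (x y : X) :
    (F.cut D).Rel D' x y ↔
      F.Rel D x y ∧ ∀ d ∈ D', d ∈ (F.cut D).clusters → (x ∈ d ↔ y ∈ d) := by
  unfold Rel
  rw [same_cut]
  rfl

theorem cut_cut_eq (F : XForest X) (D E D' : Finset (Finset X))
    (h : ∀ x y, (F.cut E).Rel D' x y ↔ F.Rel D x y) :
    ((F.cut E).cut D').clusters = (F.cut D).clusters := by
  have hDE : ∀ x y, F.Rel D x y → F.Rel E x y := fun x y hxy =>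
    ((F.rel_cut E D' x y).1 ((h x y).2 hxy)).1
  ext t
  rw [mem_cut_rel, mem_cut_rel]
  constructor
  · rintro ⟨s', hs', x, hx, ht⟩
    obtain ⟨s, hs, z, hz, hs''⟩ := (F.mem_cut_rel E s').1 hs'
    refine ⟨s, hs, x, ((hs'' x).1 hx).1, fun y => ?_⟩
    rw [ht y, hs'' y, h]
    constructor
    · rintro ⟨⟨h1, _⟩, h2⟩
      exact ⟨h1, h2⟩
    · rintro ⟨h1, h2⟩
      exact ⟨⟨h1, ((hs'' x).1 hx).2.trans (hDE _ _ h2)⟩, h2⟩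
  · rintro ⟨s, hs, x, hx, ht⟩
    refine ⟨s.filter (F.Rel E x), (F.mem_cut_rel E _).2 ⟨s, hs, x, hx, fun y => by simp⟩, x, ?_, ?_⟩
    · simp [hx, F.rel_refl E x]
    · intro y
      rw [ht y, h]
      simp only [Finset.mem_filter]
      constructor
      · rintro ⟨h1, h2⟩
        exact ⟨⟨h1, hDE _ _ h2⟩, h2⟩
      · rintro ⟨⟨h1, _⟩, h2⟩
        exact ⟨h1, h2⟩

/-- if `D`-equivalent labels are separated by `s`, the lower part is exactly below `s` -/
theorem low_of_sep (F : XForest X) (D : Finset (Finset X)) {s : Finset X}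
    (hs : s ∈ F.clusters) {x y : X} (h : F.Rel D x y) (hx : x ∈ s) (hy : y ∉ s) :
    F.Low D s x :=
  ⟨hx, fun d hd hF hds hxd => hy (hds.1 ((h.2 d hd hF).1 hxd))⟩

theorem sub_trans (F : XForest X) (D : Finset (Finset X)) (G : XForest X)
    (h : IsSubforest G (F.cut D)) : IsSubforest G F := by
  obtain ⟨D', hD', hG⟩ := h
  refine ⟨F.clusters.filter (fun s => s ∈ D ∨ ∃ d' ∈ D', ∃ x, x ∈ d' ∧ ∀ y, y ∈ d' ↔ F.Low D s y),
    Finset.filter_subset _ _, ?_⟩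
  rw [hG]
  apply cut_cut_eq
  intro x y
  rw [rel_cut]
  constructor
  · rintro ⟨h1, h2⟩
    refine ⟨h1.1, fun s hs hsF => ?_⟩
    rcases (Finset.mem_filter.mp hs).2 with hsD | ⟨d', hd', z, hz, hd's⟩
    · exact h1.2 s hsD hsF
    · have aux : ∀ x y, F.Rel D x y → (x ∈ d' ↔ y ∈ d') → x ∈ s → y ∈ s := by
        intro x y hr hiff hx
        by_contra hy
        have := F.low_of_sep D hsF hr hx hy
        exact hy ((hd's y).1 (hiff.1 ((hd's x).2 this))).1
      have h3 := h2 d' hd' (hD' hd')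
      exact ⟨aux x y h1 h3, aux y x h1.symm h3.symm⟩
  · rintro ⟨h1, h2⟩
    have hr : F.Rel D x y :=
      ⟨h1, fun d hd hF => h2 d (Finset.mem_filter.mpr ⟨hF, Or.inl hd⟩) hF⟩
    refine ⟨hr, fun d' hd' hF' => ?_⟩
    obtain ⟨⟨z, hz⟩, s, hs, hd's⟩ := (F.mem_cut_low D d').1 hF'
    have h3 := h2 s (Finset.mem_filter.mpr ⟨hs, Or.inr ⟨d', hd', z, hz, hd's⟩⟩) hs
    rw [hd's x, hd's y]
    constructor
    · intro hx
      exact (F.low_rel D hs hx y).2 ⟨h3.1 hx.1, hr⟩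
    · intro hy
      exact (F.low_rel D hs hy x).2 ⟨h3.2 hy.1, hr.symm⟩

theorem sub_of_rel (F : XForest X) (D E : Finset (Finset X)) (G : XForest X)
    (hG : G.clusters = (F.cut D).clusters) (hDF : D ⊆ F.clusters)
    (h : ∀ x y, F.Rel D x y → F.Rel E x y) : IsSubforest G (F.cut E) := by
  refine ⟨(F.cut E).clusters.filter (fun t => ∃ d ∈ D, ∀ y, y ∈ t ↔ F.Low E d y),
    Finset.filter_subset _ _, ?_⟩
  rw [hG]
  symm
  apply cut_cut_eq
  intro x y
  rw [rel_cut]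
  constructor
  · rintro ⟨h1, h2⟩
    refine ⟨h1.1, ?_⟩
    have aux : ∀ x y, F.Rel E x y → (∀ d ∈ (F.cut E).clusters.filter
        (fun t => ∃ d ∈ D, ∀ y, y ∈ t ↔ F.Low E d y), d ∈ (F.cut E).clusters → (x ∈ d ↔ y ∈ d)) →
        ∀ d ∈ D, d ∈ F.clusters → x ∈ d → y ∈ d := by
      intro x y hr hsep d hd hF hx
      by_contra hy
      have hl := F.low_of_sep E hF hr hx hy
      have hmem : ∀ z, z ∈ d.filter (F.Low E d) ↔ F.Low E d z := by
        intro z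
        simp only [Finset.mem_filter]
        exact ⟨fun h => h.2, fun h => ⟨h.1, h⟩⟩
      have hc : d.filter (F.Low E d) ∈ (F.cut E).clusters :=
        (F.mem_cut_low E _).2 ⟨⟨x, (hmem x).2 hl⟩, d, hF, hmem⟩
      have := hsep _ (Finset.mem_filter.mpr ⟨hc, d, hd, hmem⟩) hc
      exact hy ((hmem y).1 (this.1 ((hmem x).2 hl))).1
    exact fun d hd hF => ⟨aux x y h1 h2 d hd hF,
      aux y x h1.symm (fun d hd hF => (h2 d hd hF).symm) d hd hF⟩
  · intro hr
    refine ⟨h x y hr, fun t ht htF => ?_⟩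
    obtain ⟨d, hd, htd⟩ := (Finset.mem_filter.mp ht).2
    have h3 := hr.2 d hd (hDF hd)
    rw [htd x, htd y]
    constructor
    · intro hx
      exact (F.low_rel E (hDF hd) hx y).2 ⟨h3.1 hx.1, h x y hr⟩
    · intro hy
      exact (F.low_rel E (hDF hd) hy x).2 ⟨h3.2 hy.1, (h x y hr).symm⟩

/-- the component of a label -/
noncomputable def comp (F : XForest X) (x : X) : Finset X := Finset.univ.filter (F.Same x)

theorem mem_comp (F : XForest X) (x y : X) : y ∈ F.comp x ↔ F.Same x y := by
  simp [comp]

theorem comp_eq_of_same (F : XForest X) {x y : X} (h : F.Same x y) : F.comp x = F.comp y := by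
  ext z
  rw [mem_comp, mem_comp]
  exact ⟨fun h' => h.symm.trans h', fun h' => h.trans h'⟩

theorem comp_eq_iff (F : XForest X) (x y : X) : F.comp x = F.comp y ↔ F.Same x y := by
  refine ⟨fun h => ?_, F.comp_eq_of_same⟩
  rw [← mem_comp, h, mem_comp]
  exact F.same_refl y

theorem eq_comp (F : XForest X) {C : Finset X} (hC : C ∈ F.components) {x : X} (hx : x ∈ C) :
    C = F.comp x := by
  obtain ⟨hCF, hmax⟩ := Finset.mem_filter.mp hC
  ext y
  rw [mem_comp]
  constructor
  · intro hy
    exact ⟨C, hCF, hx, hy⟩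
  · rintro ⟨s, hs, hxs, hys⟩
    rcases F.lam hs hCF hxs hx with h | h
    · exact h hys
    · by_contra hy
      exact hmax s hs ⟨h, fun h' => hy (h' hys)⟩

theorem comp_mem (F : XForest X) (x : X) : F.comp x ∈ F.components := by
  have hne : (F.clusters.filter fun s => x ∈ s).Nonempty :=
    ⟨{x}, Finset.mem_filter.mpr ⟨F.singleton_mem x, by simp⟩⟩
  obtain ⟨C, hC, hmax⟩ := Finset.exists_max_image _ Finset.card hne
  obtain ⟨hCF, hxC⟩ := Finset.mem_filter.mp hC
  have hC' : C ∈ F.components := by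
    refine Finset.mem_filter.mpr ⟨hCF, fun t ht hCt => ?_⟩
    have := hmax t (Finset.mem_filter.mpr ⟨ht, hCt.1 hxC⟩)
    exact absurd (Finset.card_lt_card hCt) (not_lt.mpr this)
  rw [← F.eq_comp hC' hxC]
  exact hC'

theorem exists_comp (F : XForest X) {C : Finset X} (hC : C ∈ F.components) :
    ∃ x, C = F.comp x := by
  obtain ⟨x, hx⟩ := F.nonempty_of_mem C (Finset.mem_filter.mp hC).1
  exact ⟨x, F.eq_comp hC hx⟩

theorem ord_lower (F : XForest X) (E : Finset (Finset X)) (z : X) (W : Finset X)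
    (h1 : ∀ w ∈ W, F.Same z w) (h2 : ∀ w ∈ W, ¬ F.Rel E z w)
    (h3 : ∀ w ∈ W, ∀ w' ∈ W, F.Rel E w w' → w = w') : F.ord + W.card ≤ (F.cut E).ord := by
  have hrep : ∀ C ∈ F.components, ∃ x, C = F.comp x ∧ (F.Same z x → x = z) := by
    intro C hC
    obtain ⟨x, hx⟩ := F.exists_comp hC
    by_cases h : F.Same z x
    · exact ⟨z, hx.trans (F.comp_eq_of_same h).symm, fun _ => rfl⟩
    · exact ⟨x, hx, fun h' => absurd h' h⟩
  haveI : Nonempty X := ⟨z⟩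
  choose! r hr1 hr2 using hrep
  have hc1 : (F.components.image fun C => (F.cut E).comp (r C)).card = F.ord := by
    apply Finset.card_image_of_injOn
    intro C hC C' hC' h
    have h' := (F.same_cut E _ _).1 (((F.cut E).comp_eq_iff _ _).1 h)
    rw [hr1 C hC, hr1 C' hC', F.comp_eq_of_same h'.1]
  have hc2 : (W.image fun w => (F.cut E).comp w).card = W.card := by
    apply Finset.card_image_of_injOn
    intro w hw w' hw' h
    exact h3 w hw w' hw' ((F.same_cut E _ _).1 (((F.cut E).comp_eq_iff _ _).1 h))
  have hdis : Disjoint (F.components.image fun C => (F.cut E).comp (r C))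
      (W.image fun w => (F.cut E).comp w) := by
    rw [Finset.disjoint_left]
    intro s hs hs'
    obtain ⟨C, hC, rfl⟩ := Finset.mem_image.mp hs
    obtain ⟨w, hw, h⟩ := Finset.mem_image.mp hs'
    have h' := (F.same_cut E _ _).1 (((F.cut E).comp_eq_iff _ _).1 h)
    have hz := hr2 C hC ((h1 w hw).trans h'.1)
    rw [hz] at h'
    exact h2 w hw h'.symm
  rw [← hc1, ← hc2, ← Finset.card_union_of_disjoint hdis]
  apply Finset.card_le_card
  intro s hs
  rcases Finset.mem_union.mp hs with hs | hs
  · obtain ⟨C, hC, rfl⟩ := Finset.mem_image.mp hs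
    exact comp_mem _ _
  · obtain ⟨C, hC, rfl⟩ := Finset.mem_image.mp hs
    exact comp_mem _ _

theorem ord_cut_single (F : XForest X) (a b : X) (hab : a ≠ b) (h : F.Same a b) :
    (F.cut {({a} : Finset X)}).ord = F.ord + 1 := by
  have hrel : ∀ x y, F.Rel {({a} : Finset X)} x y ↔ F.Same x y ∧ (x = a ↔ y = a) := by
    intro x y
    simp [Rel, F.singleton_mem a]
  apply le_antisymm
  · have hsub : (F.cut {({a} : Finset X)}).components ⊆
        insert {a} (F.components.image fun C => C \ {a}) := by
      intro C hC
      obtain ⟨x, hx⟩ := exists_comp _ hC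
      rw [Finset.mem_insert]
      by_cases hxa : x = a
      · left
        rw [hx]
        ext y
        rw [mem_comp, same_cut, hrel, Finset.mem_singleton]
        constructor
        · rintro ⟨_, h⟩
          exact h.1 hxa
        · rintro rfl
          rw [hxa]
          exact ⟨F.same_refl _, Iff.rfl⟩
      · right
        refine Finset.mem_image.mpr ⟨F.comp x, F.comp_mem x, ?_⟩
        rw [hx]
        ext y
        rw [mem_comp, same_cut, hrel, Finset.mem_sdiff, mem_comp, Finset.mem_singleton]
        tauto
    refine (Finset.card_le_card hsub).trans ((Finset.card_insert_le _ _).trans ?_)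
    exact Nat.add_le_add_right Finset.card_image_le 1
  · have := F.ord_lower {({a} : Finset X)} b {a} ?_ ?_ ?_
    · simpa using this
    · intro w hw
      rw [Finset.mem_singleton.mp hw]
      exact h.symm
    · intro w hw hr
      rw [Finset.mem_singleton.mp hw] at hr
      exact hab.symm (((hrel _ _).1 hr).2.2 rfl)
    · intro w hw w' hw' _
      rw [Finset.mem_singleton.mp hw, Finset.mem_singleton.mp hw']

theorem mem_lca2 (F : XForest X) (a b x : X) :
    x ∈ F.lca2 a b ↔ ∀ s ∈ F.clusters, a ∈ s → b ∈ s → x ∈ s := by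
  simp only [lca2, Finset.mem_inf, Finset.mem_filter, id]
  grind

theorem lca2_mem (F : XForest X) {a b : X} (h : F.Same a b) : F.lca2 a b ∈ F.clusters := by
  have hne : (F.clusters.filter fun s => a ∈ s ∧ b ∈ s).Nonempty := by
    obtain ⟨s, hs, h⟩ := h
    exact ⟨s, Finset.mem_filter.mpr ⟨hs, h⟩⟩
  obtain ⟨C, hC, hmin⟩ := Finset.exists_min_image _ Finset.card hne
  obtain ⟨hCF, haC, hbC⟩ := Finset.mem_filter.mp hC
  have : F.lca2 a b = C := by
    ext x
    rw [mem_lca2]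
    constructor
    · intro h
      exact h C hCF haC hbC
    · intro hx s hs has hbs
      rcases F.lam hs hCF has haC with h | h
      · have := hmin s (Finset.mem_filter.mpr ⟨hs, has, hbs⟩)
        rw [Finset.eq_of_subset_of_card_le h this]
        exact hx
      · exact h hx
  rw [this]
  exact hCF

/-- the facts about the edges in `E(a,b)` that are needed -/
theorem eset_spec (F : XForest X) {a b : X} {d : Finset X}
    (hd : d ∈ F.Eset a b) : a ∉ d ∧ b ∉ d ∧ ∃ c, F.IsChild d c ∧ c ⊆ F.lca2 a b ∧
      ((a ∈ c ∧ (b ∉ c ∨ c = F.lca2 a b)) ∨ (b ∈ c ∧ (a ∉ c ∨ c = F.lca2 a b))) := by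
  have hsub : ∀ c ∈ F.clusters, a ∈ c → b ∈ c → F.lca2 a b ⊆ c := by
    intro c hc ha hb x hx
    exact (F.mem_lca2 a b x).1 hx c hc ha hb
  rcases Finset.mem_union.mp hd with hd | hd
  · obtain ⟨hdF, c, hcF, hch, hcl, h⟩ := Finset.mem_filter.mp hd
    have hdc := hch.2.2.1
    rcases h with ⟨hac, _, had⟩ | ⟨hbc, _, hbd⟩
    · have hbc : b ∉ c := fun hbc => hcl.2 (hsub c hcF hac hbc)
      exact ⟨had, fun h => hbc (hdc.1 h), c, hch, hcl.1, Or.inl ⟨hac, Or.inl hbc⟩⟩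
    · have hac : a ∉ c := fun hac => hcl.2 (hsub c hcF hac hbc)
      exact ⟨fun h => hac (hdc.1 h), hbd, c, hch, hcl.1, Or.inr ⟨hbc, Or.inl hac⟩⟩
  · obtain ⟨hdF, hch, had, hbd⟩ := Finset.mem_filter.mp hd
    refine ⟨had, hbd, _, hch, Finset.Subset.refl _, Or.inl ⟨?_, Or.inr rfl⟩⟩
    rw [mem_lca2]
    exact fun s _ h _ => h

theorem eset_disj (F : XForest X) {a b : X} {d e : Finset X}
    (hd : d ∈ F.Eset a b) (he : e ∈ F.Eset a b) (hne : d ≠ e) {x : X} (hx : x ∈ d) : x ∉ e := by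
  have aux : ∀ d e, d ∈ F.Eset a b → e ∈ F.Eset a b → x ∈ d → d ⊂ e → False := by
    intro d e hd he hx hde
    obtain ⟨_, _, c, hch, _, hc⟩ := F.eset_spec hd
    obtain ⟨hae, hbe, c', hch', _, _⟩ := F.eset_spec he
    have hce : ¬ c ⊆ e := by
      intro h
      rcases hc with hc | hc
      · exact hae (h hc.1)
      · exact hbe (h hc.1)
    rcases F.lam hch.2.1 hch'.1 (hch.2.2.1.1 hx) (hde.1 hx) with h | h
    · exact hce h
    · exact hch.2.2.2 e hch'.1 hde ⟨h, hce⟩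
  intro hxe
  have hdF := (F.eset_spec hd).2.2.choose_spec.1.1
  have heF := (F.eset_spec he).2.2.choose_spec.1.1
  rcases F.lam hdF heF hx hxe with h | h
  · exact aux d e hd he hx (Finset.ssubset_iff_subset_ne.mpr ⟨h, hne⟩)
  · exact aux e d he hd hxe (Finset.ssubset_iff_subset_ne.mpr ⟨h, hne.symm⟩)

theorem ord_cut_eset (F : XForest X) (a b : X) (h : F.Same a b)
    (hcase : 2 ≤ (F.Eset a b).card) : F.ord + 2 ≤ (F.cut (F.Eset a b)).ord := by
  obtain ⟨d, hd, e, he, hne⟩ := Finset.one_lt_card.mp hcase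
  obtain ⟨had, _, c, hch, hcl, _⟩ := F.eset_spec hd
  obtain ⟨hae, _, c', hch', hcl', _⟩ := F.eset_spec he
  obtain ⟨x, hx⟩ := F.nonempty_of_mem d hch.1
  obtain ⟨y, hy⟩ := F.nonempty_of_mem e hch'.1
  have hxe := F.eset_disj hd he hne hx
  have hxy : x ≠ y := fun h => hxe (h ▸ hy)
  have hal : a ∈ F.lca2 a b := (F.mem_lca2 a b a).2 fun s _ h _ => h
  have hlF := F.lca2_mem h
  have := F.ord_lower (F.Eset a b) a {x, y} ?_ ?_ ?_
  · rwa [Finset.card_pair hxy] at this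
  · intro w hw
    refine ⟨_, hlF, hal, ?_⟩
    rcases Finset.mem_insert.mp hw with rfl | hw
    · exact hcl (hch.2.2.1.1 hx)
    · rw [Finset.mem_singleton.mp hw]
      exact hcl' (hch'.2.2.1.1 hy)
  · intro w hw hr
    rcases Finset.mem_insert.mp hw with rfl | hw
    · exact had ((hr.2 d hd hch.1).2 hx)
    · rw [Finset.mem_singleton.mp hw] at hr
      exact hae ((hr.2 e he hch'.1).2 hy)
  · intro w hw w' hw' hr
    have h1 := hr.2 e he hch'.1
    rcases Finset.mem_insert.mp hw with rfl | hw
    · rcases Finset.mem_insert.mp hw' with rfl | hw'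
      · rfl
      · rw [Finset.mem_singleton.mp hw'] at h1
        exact absurd (h1.2 hy) hxe
    · rw [Finset.mem_singleton.mp hw] at h1 ⊢
      rcases Finset.mem_insert.mp hw' with rfl | hw'
      · exact absurd (h1.1 hy) hxe
      · rw [Finset.mem_singleton.mp hw']

theorem same_of_clusters_eq {F G : XForest X} (h : F.clusters = G.clusters) (x y : X) :
    F.Same x y ↔ G.Same x y := by
  unfold Same
  rw [h]

theorem same_iff_components (F : XForest X) (x y : X) :
    F.Same x y ↔ ∃ C ∈ F.components, x ∈ C ∧ y ∈ C := by
  constructor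
  · intro h
    exact ⟨F.comp x, F.comp_mem x, (F.mem_comp _ _).2 (F.same_refl x), (F.mem_comp _ _).2 h⟩
  · rintro ⟨C, hC, h⟩
    exact ⟨C, (Finset.mem_filter.mp hC).1, h⟩

theorem sub_cut_single {F G : XForest X} {a : X} (hG : IsSubforest G F)
    (h : ∀ y, G.Same a y → y = a) : IsSubforest G (F.cut {({a} : Finset X)}) := by
  obtain ⟨D, hD, hGD⟩ := hG
  apply F.sub_of_rel D _ G hGD hD
  intro x y hr
  refine ⟨hr.1, ?_⟩
  intro d hd _
  rw [Finset.mem_singleton.mp hd, Finset.mem_singleton, Finset.mem_singleton]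
  have hs : G.Same x y := (same_of_clusters_eq hGD x y).2 ((F.same_cut D x y).2 hr)
  constructor
  · rintro rfl
    exact h y hs
  · rintro rfl
    exact h x hs.symm

theorem sub_cut_eset {F G : XForest X} {a b : X} (hG : IsSubforest G F)
    (h : {a, b} ∈ G.clusters) : IsSubforest G (F.cut (F.Eset a b)) := by
  obtain ⟨D, hD, hGD⟩ := hG
  have hab : F.Rel D a b := by
    rw [← same_cut, ← same_of_clusters_eq hGD]
    exact ⟨{a, b}, h, by simp, by simp⟩
  -- every label below the lca and equivalent to `a` is `a` or `b`
  have hsmall : ∀ x ∈ F.lca2 a b, F.Rel D a x → x = a ∨ x = b := by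
    intro x hx hr
    rw [hGD] at h
    obtain ⟨s, hs, z, hz, hsz⟩ := (F.mem_cut_rel D _).1 h
    have ha := (hsz a).1 (by simp)
    have hb := (hsz b).1 (by simp)
    have hxs := (F.mem_lca2 a b x).1 hx s hs ha.1 hb.1
    simpa using (hsz x).2 ⟨hxs, ha.2.trans hr⟩
  apply F.sub_of_rel D _ G hGD hD
  have aux : ∀ x y, F.Rel D x y → ∀ e ∈ F.Eset a b, x ∈ e → y ∈ e := by
    intro x y hr e he hxe
    by_contra hye
    obtain ⟨hae, hbe, c, hch, hcl, hc⟩ := F.eset_spec he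
    have hxc := hch.2.2.1.1 hxe
    have main : ∀ u v, F.Rel D u v → u ∈ c → u ∉ e → (v ∉ c ∨ c = F.lca2 a b) →
        (∀ s ∈ F.clusters, u ∈ s → v ∈ s → F.lca2 a b ⊆ s) → F.Rel D u x := by
      intro u v huv huc hue hv hl
      refine ⟨⟨c, hch.2.1, huc, hxc⟩, fun d hd hF => ⟨fun hud => ?_, fun hxd => ?_⟩⟩
      · by_contra hxd
        have hvd := (huv.2 d hd hF).1 hud
        exact hxd (hl d hF hud hvd (hcl hxc))
      · by_contra hud
        have hdc : d ⊂ c := by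
          rcases F.lam hF hch.2.1 hxd hxc with h | h
          · exact ⟨h, fun h' => hud (h' huc)⟩
          · exact absurd (h huc) hud
        have hyd := (hr.2 d hd hF).1 hxd
        rcases F.lam hF hch.1 hxd hxe with h | h
        · exact hye (h hyd)
        · exact hch.2.2.2 d hF ⟨h, fun h' => hye (h' hyd)⟩ hdc
    have hlca : ∀ s ∈ F.clusters, a ∈ s → b ∈ s → F.lca2 a b ⊆ s := by
      intro s hs ha hb z hz
      exact (F.mem_lca2 a b z).1 hz s hs ha hb
    have hax : F.Rel D a x := by
      rcases hc with ⟨hac, h⟩ | ⟨hbc, h⟩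
      · exact main a b hab hac hae h hlca
      · exact hab.trans (main b a hab.symm hbc hbe h fun s hs h1 h2 => hlca s hs h2 h1)
    rcases hsmall x (hcl hxc) hax with rfl | rfl
    · exact hae hxe
    · exact hbe hxe
  intro x y hr
  exact ⟨hr.1, fun e he _ => ⟨aux x y hr e he, aux y x hr.symm e he⟩⟩

/-- the trichotomy at a sibling pair -/
theorem mss_cases {F G : XForest X} {a b : X} (hM : F.IsMSS {a, b}) (hG : IsSubforest G F) :
    (∀ y, G.Same a y → y = a) ∨ (∀ y, G.Same b y → y = b) ∨ {a, b} ∈ G.clusters := by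
  obtain ⟨D, hD, hGD⟩ := hG
  have hsame : ∀ x y, G.Same x y ↔ F.Rel D x y := fun x y => by
    rw [← same_cut, ← same_of_clusters_eq hGD]
  by_cases h1 : ({a} : Finset X) ∈ D
  · left
    intro y hy
    have := (((hsame a y).1 hy).2 {a} h1 (F.singleton_mem a)).1 (by simp)
    simpa using this
  by_cases h2 : ({b} : Finset X) ∈ D
  · right; left
    intro y hy
    have := (((hsame b y).1 hy).2 {b} h2 (F.singleton_mem b)).1 (by simp)
    simpa using this
  right; right
  obtain ⟨hF, _, hsub⟩ := hM
  have key : ∀ d ∈ D, ∀ x, x ∈ d → x ∈ ({a, b} : Finset X) → {a, b} ⊆ d := by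
    intro d hd x hxd hx
    rcases F.lam (hD hd) hF hxd hx with h | h
    · by_contra hcon
      have hcard := hsub d (hD hd) ⟨h, hcon⟩
      obtain ⟨z, rfl⟩ := Finset.card_eq_one.mp hcard
      have hz := h (Finset.mem_singleton_self z)
      rcases Finset.mem_insert.mp hz with rfl | hz
      · exact h1 hd
      · rw [Finset.mem_singleton.mp hz] at hd
        exact h2 hd
    · exact h
  have hl : ∀ x ∈ ({a, b} : Finset X), F.Low D {a, b} x :=
    fun x hx => ⟨hx, fun d hd _ hds hxd => hds.2 (key d hd x hxd hx)⟩
  rw [hGD, mem_cut_low]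
  exact ⟨⟨a, by simp⟩, {a, b}, hF, fun x => ⟨fun hx => hl x hx, fun hx => hx.1⟩⟩

end XForest

theorem ordMax_const {X : Type*} [DecidableEq X] [Fintype X] {m : ℕ} (hm : 0 < m)
    (I : Inst X m) (N : ℕ) (h : ∀ i, (I.F i).ord = N) : I.ordMax = N := by
  apply le_antisymm
  · exact Finset.sup_le fun i _ => (h i).le
  · rw [← h ⟨0, hm⟩]
    exact Finset.le_sup (f := fun i => (I.F i).ord) (Finset.mem_univ _)

end Helpers

/-- Lemma 4.3, Branching Rule 2.1.  Let `(F_1, …, F_m; k)`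
satisfy the label-set isomorphism property with `{a,b}` a minimum MSS lying in
`F_1`, and suppose some `F_p` has `|E_{F_p}(a,b)| ≥ 2` (Case 2.1).  Then
Branching Rule 2.1 — [1] remove the edge incident to `a` in all forests;
[2] remove the edge incident to `b` in all forests; [3] remove the edges of
`E_{F_i}(a,b)` in every `F_i`, `2 ≤ i ≤ m` — is safe and satisfies the
recurrence relation `T(k) ≤ 2·T(k-1) + T(k-2)`. -/
theorem statement_10 {X : Type*} [DecidableEq X] [Fintype X] {m : ℕ} (hm : 0 < m)
    (I I₁ I₂ I₃ : Inst X m) (a b : X) (hab : a ≠ b)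
    (hiso : InstLabelIso I)
    (hMSS : I.MinMSS ⟨0, hm⟩ {a, b})
    (p : Fin m) (hp : p ≠ ⟨0, hm⟩)
    (hcase : 2 ≤ ((I.F p).Eset a b).card)
    (hI₁F : I₁.F = fun i => (I.F i).cut {({a} : Finset X)}) (hI₁k : I₁.k = I.k - 1)
    (hI₂F : I₂.F = fun i => (I.F i).cut {({b} : Finset X)}) (hI₂k : I₂.k = I.k - 1)
    (hI₃F : I₃.F = fun i =>
      if i = ⟨0, hm⟩ then I.F i else (I.F i).cut ((I.F i).Eset a b))
    (hI₃k : I₃.k = I.k + I.ordMax - I₃.ordMax) :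
    (I.IsYes ↔ I₁.IsYes ∨ I₂.IsYes ∨ I₃.IsYes) ∧
    I₃.k ≤ I.k - 2 ∧
    RecBound I.k [I₁.k, I₂.k, I₃.k] 2 1 := by
  obtain ⟨F0mss, -⟩ := hMSS
  have hs0 : (I.F ⟨0, hm⟩).Same a b := by
    refine ⟨{a, b}, ?_, by simp, by simp⟩
    convert F0mss.1
  have hsame : ∀ i, (I.F i).Same a b := by
    intro i
    rw [XForest.same_iff_components, hiso i ⟨0, hm⟩, ← XForest.same_iff_components]
    exact hs0
  have hord : ∀ i, (I.F i).ord = (I.F ⟨0, hm⟩).ord := by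
    intro i
    unfold XForest.ord
    rw [hiso i ⟨0, hm⟩]
  have hN := ordMax_const hm I _ hord
  have hN₁ : I₁.ordMax = (I.F ⟨0, hm⟩).ord + 1 := by
    apply ordMax_const hm
    intro i
    rw [hI₁F, ← hord i]
    exact XForest.ord_cut_single _ a b hab (hsame i)
  have hN₂ : I₂.ordMax = (I.F ⟨0, hm⟩).ord + 1 := by
    apply ordMax_const hm
    intro i
    rw [hI₂F, ← hord i]
    exact XForest.ord_cut_single _ b a hab.symm (hsame i).symm
  have hN₃ : (I.F ⟨0, hm⟩).ord + 2 ≤ I₃.ordMax := by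
    have h1 : (I₃.F p).ord ≤ I₃.ordMax :=
      Finset.le_sup (f := fun i => (I₃.F i).ord) (Finset.mem_univ p)
    refine le_trans ?_ h1
    rw [hI₃F, ← hord p]
    simp only [if_neg hp]
    exact XForest.ord_cut_eset _ a b (hsame p) hcase
  have hk₃ : I₃.k ≤ I.k - 2 := by
    rw [hI₃k, hN]
    omega
  refine ⟨⟨?_, ?_⟩, hk₃, ?_⟩
  · rintro ⟨G, hG, hk⟩
    rcases XForest.mss_cases F0mss (hG ⟨0, hm⟩) with h | h | h
    · refine Or.inl ⟨G, ?_, by omega⟩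
      intro i
      rw [hI₁F]
      exact XForest.sub_cut_single (hG i) h
    · refine Or.inr (Or.inl ⟨G, ?_, by omega⟩)
      intro i
      rw [hI₂F]
      exact XForest.sub_cut_single (hG i) h
    · refine Or.inr (Or.inr ⟨G, ?_, by omega⟩)
      intro i
      rw [hI₃F]
      by_cases hi : i = ⟨0, hm⟩
      · simp only [if_pos hi]
        exact hG i
      · simp only [if_neg hi]
        exact XForest.sub_cut_eset (hG i) h
  · rintro (⟨G, hG, hk⟩ | ⟨G, hG, hk⟩ | ⟨G, hG, hk⟩)
    · refine ⟨G, fun i => ?_, by omega⟩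
      have := hG i
      rw [hI₁F] at this
      exact XForest.sub_trans _ _ _ this
    · refine ⟨G, fun i => ?_, by omega⟩
      have := hG i
      rw [hI₂F] at this
      exact XForest.sub_trans _ _ _ this
    · refine ⟨G, fun i => ?_, by omega⟩
      have := hG i
      rw [hI₃F] at this
      by_cases hi : i = ⟨0, hm⟩
      · simp only [if_pos hi] at this
        exact this
      · simp only [if_neg hi] at this
        exact XForest.sub_trans _ _ _ this
  · intro T _ hmono hrec
    have h1 := hrec I.k
    have h2 := hmono hk₃
    simp only [List.map_cons, List.map_nil, List.sum_cons, List.sum_nil, hI₁k, hI₂k]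
    push_cast at h1
    linarith
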